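/- Let r be an integer with 2 ≤ r ≤ q−1, and let f be a nonzero element of the k-linear span of the set {x^{jq+i} : q > i > j ≥ 0 and jq+i ≡ r (mod q−1)} in k[x]₀. Then W_1 + {f}^S = k[x]₀. -/

import Mathlib

open Polynomial

variable (k : Type*) [Field k] [Fintype k]

/-- `k[x]₀`: the free non-unital associative `k`-algebra on one generator `x`,
identified with the polynomials over `k` with zero constant term,
viewed as a `k`-submodule of `Polynomial k`. -/
noncomputable def A0 : Submodule k (Polynomial k) :=
  LinearMap.ker (Polynomial.aeval (0 : k)).toLinearMap

/-- A `T`-space of `k[x]₀`: a `k`-linear subspace of `k[x]₀` closed under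
substitutions `f ↦ f ∘ g` for `g ∈ k[x]₀`. -/
def IsTSpace (V : Submodule k (Polynomial k)) : Prop :=
  V ≤ A0 k ∧ ∀ f ∈ V, ∀ g ∈ A0 k, f.comp g ∈ V

/-- `H^S`: the smallest `T`-space of `k[x]₀` containing `H`. -/
noncomputable def TSp (H : Set (Polynomial k)) : Submodule k (Polynomial k) :=
  sInf {V | IsTSpace k V ∧ H ⊆ V}

/-- A `T`-ideal of `k[x]₀`: a `T`-space that is also an ideal of `k[x]₀`. -/
def IsTIdeal (V : Submodule k (Polynomial k)) : Prop :=
  IsTSpace k V ∧ ∀ f ∈ V, ∀ g ∈ A0 k, g * f ∈ V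

/-- `H^T`: the smallest `T`-ideal of `k[x]₀` containing `H`. -/
noncomputable def TId (H : Set (Polynomial k)) : Submodule k (Polynomial k) :=
  sInf {V | IsTIdeal k V ∧ H ⊆ V}

/-- `W_n = {x + x^{q^n}}^S + {x^{q^n+1}}^S`, where `q` is the order of `k`. -/
noncomputable def Wn (n : ℕ) : Submodule k (Polynomial k) :=
  TSp k {X + X ^ (Fintype.card k ^ n)} ⊔ TSp k {X ^ (Fintype.card k ^ n + 1)}

/-- `U_n = {x - x^{q^{2n}}}^T`, where `q` is the order of `k`. -/
noncomputable def Un (n : ℕ) : Submodule k (Polynomial k) :=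
  TId k {X - X ^ (Fintype.card k ^ (2 * n))}

section aux

lemma mem_A0' (h : k[X]) : h ∈ A0 k ↔ h.eval 0 = 0 := by
  simp [A0, Polynomial.coe_aeval_eq_eval]

lemma A0_isT : IsTSpace k (A0 k) := by
  refine ⟨le_rfl, fun f hf g hg => ?_⟩
  rw [mem_A0'] at *
  rw [eval_comp, hg, hf]

lemma TSp_le {H : Set k[X]} (hH : H ⊆ A0 k) : TSp k H ≤ A0 k :=
  sInf_le ⟨A0_isT k, hH⟩

lemma comp_mem_TSp {f g : k[X]} (hg : g ∈ A0 k) : f.comp g ∈ TSp k {f} := by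
  rw [TSp, Submodule.mem_sInf]
  rintro V ⟨hV, hf⟩
  exact hV.2 f (hf rfl) g hg

lemma add_mem_W {g : k[X]} (hg : g ∈ A0 k) : g + g ^ Fintype.card k ∈ Wn k 1 := by
  have := comp_mem_TSp k (f := X + X ^ (Fintype.card k ^ 1)) hg
  refine Submodule.mem_sup_left ?_
  simpa using this

lemma pow_mem_W {g : k[X]} (hg : g ∈ A0 k) : g ^ (Fintype.card k + 1) ∈ Wn k 1 := by
  have := comp_mem_TSp k (f := X ^ (Fintype.card k ^ 1 + 1)) hg
  refine Submodule.mem_sup_right ?_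
  simpa using this

lemma frob_add (a b : k[X]) :
    (a + b) ^ Fintype.card k = a ^ Fintype.card k + b ^ Fintype.card k := by
  obtain ⟨p, hp⟩ := CharP.exists k
  obtain ⟨n, hpp, hn⟩ := FiniteField.card k p
  haveI := Fact.mk hpp
  rw [hn, add_pow_char_pow]

lemma polar_mem_W {a b : k[X]} (ha : a ∈ A0 k) (hb : b ∈ A0 k) :
    a ^ Fintype.card k * b + a * b ^ Fintype.card k ∈ Wn k 1 := by
  have h := (Wn k 1).sub_mem ((Wn k 1).sub_mem (pow_mem_W k ((A0 k).add_mem ha hb))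
    (pow_mem_W k ha)) (pow_mem_W k hb)
  convert h using 1
  rw [pow_succ (a + b), frob_add]
  ring

lemma X_pow_mem {n : ℕ} (hn : n ≠ 0) : (X ^ n : k[X]) ∈ A0 k := by
  rw [mem_A0']; simp [hn]

lemma basic_mem (n : ℕ) :
    (X ^ n * (X ^ (Fintype.card k ^ 2) - X) : k[X]) ∈ Wn k 1 := by
  have hq : Fintype.card k ≠ 0 := Fintype.card_ne_zero
  have h1 := add_mem_W k (X_pow_mem k (n := n + 1) (Nat.succ_ne_zero n))
  rcases Nat.eq_zero_or_pos n with rfl | hn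
  · have h2 := add_mem_W k (X_pow_mem k hq)
    convert (Wn k 1).sub_mem h2 h1 using 1
    ring
  · have h2 := polar_mem_W k (X_pow_mem k hq) (X_pow_mem k hn.ne')
    convert (Wn k 1).sub_mem h2 h1 using 1
    ring

lemma mul_mem_W (P : k[X]) : P * (X ^ (Fintype.card k ^ 2) - X) ∈ Wn k 1 := by
  induction P using Polynomial.induction_on' with
  | add p q hp hq => rw [add_mul]; exact (Wn k 1).add_mem hp hq
  | monomial n a =>
    rw [← C_mul_X_pow_eq_monomial, mul_assoc, ← smul_eq_C_mul]
    exact (Wn k 1).smul_mem _ (basic_mem k n)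

variable (K : Type*) [Field K] [Fintype K] [Algebra k K]

lemma eq_zero_of_vanish (hK : Fintype.card K = Fintype.card k ^ 2) (h : k[X])
    (hd : h.degree < (Fintype.card k ^ 2 : ℕ)) (hv : ∀ α : K, aeval α h = 0) : h = 0 := by
  by_contra h0
  have h1 : h.map (algebraMap k K) = 0 := by
    refine Polynomial.eq_zero_of_natDegree_lt_card_of_eval_eq_zero _ Function.injective_id
      (fun α => ?_) ?_
    · simpa [aeval_def, eval_map] using hv α
    · rw [natDegree_map, hK]
      exact (natDegree_lt_iff_degree_lt h0).2 hd
  exact h0 ((Polynomial.map_eq_zero _).1 h1)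

lemma mem_W_of_vanish (hK : Fintype.card K = Fintype.card k ^ 2) (h : k[X])
    (hv : ∀ α : K, aeval α h = 0) : h ∈ Wn k 1 := by
  have hq : 1 < Fintype.card k ^ 2 := Nat.one_lt_pow two_ne_zero Fintype.one_lt_card
  have hm : (X ^ (Fintype.card k ^ 2) - X : k[X]).Monic :=
    monic_X_pow_sub (by rw [degree_X]; exact_mod_cast hq)
  have hz : ∀ α : K, aeval α (X ^ (Fintype.card k ^ 2) - X : k[X]) = 0 := by
    intro α
    simp [← hK, FiniteField.pow_card]
  have hdeg : (X ^ (Fintype.card k ^ 2) - X : k[X]).degree = (Fintype.card k ^ 2 : ℕ) := by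
    rw [degree_sub_eq_left_of_degree_lt] <;> simp [degree_X_pow]
    exact_mod_cast hq
  have hmod : h %ₘ (X ^ (Fintype.card k ^ 2) - X) = 0 := by
    apply eq_zero_of_vanish k K hK
    · rw [← hdeg]; exact degree_modByMonic_lt _ hm
    · intro α
      rw [modByMonic_eq_sub_mul_div, map_sub, map_mul, hv, hz]; simp
  obtain ⟨P, rfl⟩ := (modByMonic_eq_zero_iff_dvd hm).1 hmod
  rw [mul_comm]; exact mul_mem_W k P

lemma exists_idem_aux (hK : Fintype.card K = Fintype.card k ^ 2) (β : K) (hβ : β ≠ 0) :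
    ∃ e ∈ A0 k, aeval β e = 1 ∧ ∀ γ : K, aeval γ (minpoly k β) ≠ 0 → aeval γ e = 0 := by
  have hz : ∀ α : K, aeval α (X ^ (Fintype.card k ^ 2) - X : k[X]) = 0 := by
    intro α
    simp [← hK, FiniteField.pow_card]
  obtain ⟨M, hM⟩ := minpoly.dvd k β (hz β)
  have hγ : ∀ γ : K, aeval γ (minpoly k β) ≠ 0 → aeval γ M = 0 := by
    intro γ hγ
    have := hz γ
    rw [hM, map_mul] at this
    exact (mul_eq_zero.1 this).resolve_left hγ
  have hMβ : aeval β M ≠ 0 := by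
    intro h0
    have := congrArg (fun p => aeval β (derivative p)) hM
    simp [derivative_mul, h0, minpoly.aeval, derivative_X_pow, FiniteField.cast_card_eq_zero] at this
  have hc : Fintype.card K - 1 ≠ 0 := by
    have := Fintype.one_lt_card (α := K); omega
  have hM0 : M.eval 0 = 0 := by
    have h1 : aeval (0 : K) M = 0 := by
      apply hγ
      intro h2
      have h3 : (minpoly k β).coeff 0 = 0 := by
        simpa [aeval_def, eval₂_at_zero] using h2
      exact hβ ((minpoly.coeff_zero_eq_zero (Algebra.IsIntegral.isIntegral β)).1 h3)
    simpa [aeval_def, eval₂_at_zero, coeff_zero_eq_eval_zero] using h1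
  refine ⟨M ^ (Fintype.card K - 1), ?_, ?_, ?_⟩
  · rw [mem_A0', eval_pow, hM0, zero_pow hc]
  · rw [map_pow, FiniteField.pow_card_sub_one_eq_one _ hMβ]
  · intro γ h
    rw [map_pow, hγ γ h, zero_pow hc]

lemma span_two (hK : Module.finrank k K = 2) (c : K) (hc : c ∉ Set.range (algebraMap k K))
    (τ : K) : ∃ x y : k, τ = algebraMap k K x + algebraMap k K y * c := by
  have hli : LinearIndependent k ![(1 : K), c] := by
    rw [LinearIndependent.pair_iff' one_ne_zero]
    intro a ha
    exact hc ⟨a, by rw [← ha, Algebra.smul_def, mul_one]⟩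
  have hs := hli.span_eq_top_of_card_eq_finrank' (by simp [hK])
  have : τ ∈ Submodule.span k (Set.range ![(1 : K), c]) := by rw [hs]; trivial
  rw [Matrix.range_cons, Matrix.range_cons, Matrix.range_empty, Set.union_empty,
    Set.singleton_union, Submodule.mem_span_pair] at this
  obtain ⟨x, y, rfl⟩ := this
  exact ⟨x, y, by simp [Algebra.smul_def]⟩

lemma main_ind (hK : Fintype.card K = Fintype.card k ^ 2) (hK2 : Module.finrank k K = 2)
    (f : k[X]) (hf : f ∈ A0 k) (α : K) (hα : aeval α f ∉ Set.range (algebraMap k K)) :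
    ∀ (n : ℕ) (h : k[X]), h ∈ A0 k → Set.ncard {γ : K | aeval γ h ≠ 0} = n →
      h ∈ Wn k 1 ⊔ TSp k {f} := by
  intro n
  induction n using Nat.strong_induction_on with
  | _ n ih =>
  intro h hh hn
  by_cases hv : ∀ γ : K, aeval γ h = 0
  · exact Submodule.mem_sup_left (mem_W_of_vanish k K hK h hv)
  push Not at hv
  obtain ⟨β, hβ⟩ := hv
  have hβ0 : β ≠ 0 := by
    rintro rfl
    rw [mem_A0', ← coeff_zero_eq_eval_zero] at hh
    apply hβ
    simp [aeval_def, eval₂_at_zero, hh]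
  obtain ⟨e, heA, he1, he0⟩ := exists_idem_aux k K hK β hβ0
  have heA' := (mem_A0' k e).1 heA
  have key : ∃ v ∈ Wn k 1 ⊔ TSp k {f}, v ∈ A0 k ∧ aeval β v = aeval β h ∧
      ∀ γ : K, aeval γ (minpoly k β) ≠ 0 → aeval γ v = 0 := by
    have hmem : e ^ (Fintype.card k + 1) ∈ Wn k 1 ⊔ TSp k {f} :=
      Submodule.mem_sup_left (pow_mem_W k heA)
    have hA : e ^ (Fintype.card k + 1) ∈ A0 k := by
      rw [mem_A0', eval_pow, heA', zero_pow (Nat.succ_ne_zero _)]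
    by_cases hβk : β ∈ Set.range (algebraMap k K)
    · obtain ⟨b, rfl⟩ := hβk
      refine ⟨h.eval b • e ^ (Fintype.card k + 1), Submodule.smul_mem _ _ hmem,
        Submodule.smul_mem _ _ hA, ?_, ?_⟩
      · rw [map_smul, map_pow, he1, one_pow, Algebra.smul_def, mul_one, aeval_algebraMap_apply,
          coe_aeval_eq_eval]
      · intro γ hγ
        rw [map_smul, map_pow, he0 γ hγ, zero_pow (Nat.succ_ne_zero _), smul_zero]
    · obtain ⟨x, y, hxy⟩ := span_two k K hK2 β hβk α
      obtain ⟨a, b, hab⟩ := span_two k K hK2 _ hα (aeval β h)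
      have hg : (C x + C y * X) * e ∈ A0 k := by
        rw [mem_A0', eval_mul, heA', mul_zero]
      refine ⟨a • e ^ (Fintype.card k + 1) + b • f.comp ((C x + C y * X) * e),
        Submodule.add_mem _ (Submodule.smul_mem _ _ hmem)
          (Submodule.smul_mem _ _ (Submodule.mem_sup_right (comp_mem_TSp k hg))),
        Submodule.add_mem _ (Submodule.smul_mem _ _ hA)
          (Submodule.smul_mem _ _ ((A0_isT k).2 f hf _ hg)), ?_, ?_⟩
      · rw [map_add, map_smul, map_smul, map_pow, he1, aeval_comp, map_mul, he1, hab]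
        simp [Algebra.smul_def, ← hxy]
      · intro γ hγ
        have hf0 : aeval (0 : K) f = 0 := by
          rw [mem_A0', ← coeff_zero_eq_eval_zero] at hf
          simp [aeval_def, eval₂_at_zero, hf]
        rw [map_add, map_smul, map_smul, map_pow, aeval_comp, map_mul, he0 γ hγ, mul_zero, hf0]
        simp
  obtain ⟨v, hvV, hvA, hvβ, hv0⟩ := key
  have hlt : Set.ncard {γ : K | aeval γ (h - v) ≠ 0} < n := by
    rw [← hn]
    refine Set.ncard_lt_ncard ?_ (Set.toFinite _)
    refine ⟨fun γ hγ => ?_, fun hsub => ?_⟩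
    · by_cases hm : aeval γ (minpoly k β) = 0
      · exfalso
        apply hγ
        obtain ⟨Q, hQ⟩ := minpoly.dvd k β (p := h - v) (by rw [map_sub, hvβ, sub_self])
        rw [hQ, map_mul, hm, zero_mul]
      · have := hv0 γ hm
        simpa [map_sub, this] using hγ
    · have := hsub (show β ∈ {γ : K | aeval γ h ≠ 0} from hβ)
      simp [hvβ] at this
  have := ih _ hlt (h - v) ((A0 k).sub_mem hh hvA) rfl
  have h2 := Submodule.add_mem _ this hvV
  rwa [sub_add_cancel] at h2

lemma exists_value (hK : Fintype.card K = Fintype.card k ^ 2) (r : ℕ) (f : k[X])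
    (hf : f ∈ Submodule.span k
      {p : Polynomial k | ∃ i j : ℕ, j < i ∧ i < Fintype.card k ∧
        (j * Fintype.card k + i) % (Fintype.card k - 1) = r % (Fintype.card k - 1) ∧
        p = X ^ (j * Fintype.card k + i)})
    (hf0 : f ≠ 0) : f ∈ A0 k ∧ ∃ α : K, aeval α f ∉ Set.range (algebraMap k K) := by
  set q := Fintype.card k with hq
  have hfrob : ∀ a b : K, (a + b) ^ q = a ^ q + b ^ q := by
    intro a b
    obtain ⟨p, hp⟩ := CharP.exists k
    obtain ⟨n, hpp, hn⟩ := FiniteField.card k p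
    haveI := Fact.mk hpp
    haveI : CharP K p := charP_of_injective_algebraMap (algebraMap k K).injective p
    rw [hq, hn, add_pow_char_pow]
  have hpos : 0 < q := Fintype.card_pos
  have key : (∀ n, ¬ n / q < n % q → f.coeff n = 0) ∧ f.degree < (q ^ 2 : ℕ) ∧
      ∃ g : k[X], (∀ n, ¬ n % q < n / q → g.coeff n = 0) ∧ g.degree < (q ^ 2 : ℕ) ∧
        ∀ α : K, aeval α g = (aeval α f) ^ q := by
    clear hf0
    induction hf using Submodule.span_induction with
    | mem p hp =>
      obtain ⟨i, j, hji, hiq, -, rfl⟩ := hp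
      have hd : ∀ s t : ℕ, t < q → (s * q + t) / q = s ∧ (s * q + t) % q = t := by
        intro s t ht
        constructor
        · rw [mul_comm, Nat.mul_add_div hpos, Nat.div_eq_of_lt ht, add_zero]
        · rw [mul_comm, Nat.mul_add_mod, Nat.mod_eq_of_lt ht]
      have hb : ∀ s t : ℕ, s < q → t < q → s * q + t < q ^ 2 := by
        intro s t hs ht
        nlinarith
      refine ⟨?_, ?_, X ^ (i * q + j), ?_, ?_, ?_⟩
      · intro n hn
        rw [coeff_X_pow, if_neg]
        rintro rfl
        rw [(hd j i hiq).1, (hd j i hiq).2] at hn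
        exact hn hji
      · rw [degree_X_pow]; exact_mod_cast hb j i (hji.trans hiq) hiq
      · intro n hn
        rw [coeff_X_pow, if_neg]
        rintro rfl
        rw [(hd i j (hji.trans hiq)).1, (hd i j (hji.trans hiq)).2] at hn
        exact hn hji
      · rw [degree_X_pow]; exact_mod_cast hb i j hiq (hji.trans hiq)
      · intro α
        have h2 : α ^ (q * q) = α := by
          rw [← sq, ← hK, FiniteField.pow_card]
        rw [map_pow, map_pow, aeval_X, ← pow_mul, add_mul, pow_add, pow_add, mul_assoc j,
          mul_comm j, pow_mul α (q * q), h2, mul_comm]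
    | zero => exact ⟨by simp, by rw [degree_zero]; exact WithBot.bot_lt_coe _, 0, by simp,
        by rw [degree_zero]; exact WithBot.bot_lt_coe _, by simp [hpos.ne']⟩
    | add a b _ _ ha hb =>
      obtain ⟨a1, a2, g, a3, a4, a5⟩ := ha
      obtain ⟨b1, b2, g', b3, b4, b5⟩ := hb
      refine ⟨fun n hn => by rw [coeff_add, a1 n hn, b1 n hn, add_zero],
        (degree_add_le _ _).trans_lt (max_lt a2 b2), g + g',
        fun n hn => by rw [coeff_add, a3 n hn, b3 n hn, add_zero],
        (degree_add_le _ _).trans_lt (max_lt a4 b4), fun α => ?_⟩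
      rw [map_add, map_add, hfrob, a5, b5]
    | smul c a _ ha =>
      obtain ⟨a1, a2, g, a3, a4, a5⟩ := ha
      refine ⟨fun n hn => by rw [coeff_smul, a1 n hn, smul_zero],
        (degree_smul_le _ _).trans_lt a2, c • g,
        fun n hn => by rw [coeff_smul, a3 n hn, smul_zero],
        (degree_smul_le _ _).trans_lt a4, fun α => ?_⟩
      rw [map_smul, map_smul, a5, _root_.smul_pow, hq, FiniteField.pow_card]
  obtain ⟨h1, h2, g, h3, h4, h5⟩ := key
  refine ⟨?_, ?_⟩
  · rw [mem_A0', ← coeff_zero_eq_eval_zero]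
    exact h1 0 (by simp)
  · by_contra hcon
    push Not at hcon
    have h6 : g - f = 0 := by
      apply eq_zero_of_vanish k K hK
      · exact (degree_sub_le _ _).trans_lt (max_lt h4 h2)
      · intro α
        obtain ⟨a, ha⟩ := hcon α
        rw [map_sub, h5, ← ha, ← map_pow, hq, FiniteField.pow_card, sub_self]
    apply hf0
    ext n
    by_cases hn : n / q < n % q
    · rw [← sub_eq_zero.1 h6, h3 n (by omega), coeff_zero]
    · rw [h1 n hn, coeff_zero]

end aux

/-- For `2 ≤ r ≤ q - 1`, if `f` is a nonzero element of the span of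
`{x^{jq+i} : q > i > j ≥ 0, jq+i ≡ r (mod q-1)}`, then `W_1 + {f}^S = k[x]₀`. -/
theorem W1_sup_TSp_singleton_eq_top_of_class (r : ℕ) (hr2 : 2 ≤ r)
    (hrq : r ≤ Fintype.card k - 1) (f : Polynomial k)
    (hf : f ∈ Submodule.span k
      {p : Polynomial k | ∃ i j : ℕ, j < i ∧ i < Fintype.card k ∧
        (j * Fintype.card k + i) % (Fintype.card k - 1) = r % (Fintype.card k - 1) ∧
        p = X ^ (j * Fintype.card k + i)})
    (hf0 : f ≠ 0) :
    Wn k 1 ⊔ TSp k {f} = A0 k := by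
  obtain ⟨p, hp⟩ := CharP.exists k
  obtain ⟨n, hpp, hn⟩ := FiniteField.card k p
  haveI := Fact.mk hpp
  let K := FiniteField.Extension k p 2
  haveI : Finite K := inferInstance
  letI : Fintype K := Fintype.ofFinite K
  have hK2 : Module.finrank k K = 2 := FiniteField.finrank_extension k p 2
  have hK : Fintype.card K = Fintype.card k ^ 2 := by
    rw [Module.card_eq_pow_finrank (K := k) (V := K), hK2]
  obtain ⟨hfA, α, hα⟩ := exists_value k K hK r f hf hf0
  apply le_antisymm
  · refine sup_le (sup_le ?_ ?_) ?_ <;> refine TSp_le k ?_ <;> rw [Set.singleton_subset_iff]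
    · rw [SetLike.mem_coe, mem_A0']; simp
    · rw [SetLike.mem_coe, mem_A0']; simp
    · exact hfA
  · intro h hh
    exact main_ind k K hK hK2 f hfA α hα _ h hh rfl
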